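/- For the sequence a_n = n log n (n ≥ 2), u_n = a_{n-1}a_{n+1}/a_n^2 satisfies u_n = 1 + (-1 - 1/log n - 1/(log n)^2)/n^2 + o(1/n^{3}), and consequently {a_n} satisfies the higher order Turán inequality 4(a_n^2 - a_{n-1}a_{n+1})(a_{n+1}^2 - a_n a_{n+2}) - (a_n a_{n+1} - a_{n-1} a_{n+2})^2 > 0 for all sufficiently large n. -/

import Mathlib

open Real Filter Asymptotics

lemma aux_prod (x : ℝ) (h0 : 0 < x) (h1 : x ≤ 1/2) :
    |Real.log (1 - x) * Real.log (1 + x) + x^2| ≤ 15 * x^4 := by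
  have k1 := Real.abs_log_sub_add_sum_range_le (x := x) (by rw [abs_of_pos h0]; linarith) 2
  have k2 := Real.abs_log_sub_add_sum_range_le (x := -x)
    (by rw [abs_neg, abs_of_pos h0]; linarith) 2
  rw [abs_neg] at k2
  rw [abs_of_pos h0] at k1 k2
  have hb : x^(2+1) / (1 - x) ≤ 2 * x^3 := by
    rw [div_le_iff₀ (by linarith)]
    have h := mul_nonneg (pow_pos h0 3).le (by linarith : 0 ≤ 1 - 2*x)
    have e : x^3 * (1 - 2*x) = 2 * x^3 * (1 - x) - x^(2+1) := by ring
    rw [e] at h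
    exact sub_nonneg.1 h
  have k1 := k1.trans hb
  have k2 := k2.trans hb
  simp only [Finset.sum_range_succ, Finset.sum_range_zero] at k1 k2
  norm_num at k1 k2
  obtain ⟨r, hr⟩ : ∃ r, r = x + x^2/2 + Real.log (1 - x) := ⟨_, rfl⟩
  obtain ⟨s, hs⟩ : ∃ s, s = -x + x^2/2 + Real.log (1 + x) := ⟨_, rfl⟩
  rw [← hr] at k1
  rw [← hs] at k2
  have e1 : Real.log (1 - x) = r - x - x^2/2 := by linarith
  have e2 : Real.log (1 + x) = s + x - x^2/2 := by linarith
  rw [e1, e2]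
  have e : (r - x - x^2/2) * (s + x - x^2/2) + x^2
      = x^4/4 + r * (x - x^2/2) + s * (-x - x^2/2) + r * s := by ring
  rw [e]
  have x2 : x^2 ≤ x := by nlinarith
  have x6 : x^3 * x^3 ≤ x^4 := by
    have : x^2 ≤ 1 := by nlinarith
    nlinarith [pow_pos h0 4]
  have b1 : |r * (x - x^2/2)| ≤ (2*x^3) * x := by
    rw [abs_mul]
    refine mul_le_mul k1 ?_ (abs_nonneg _) (by positivity)
    rw [abs_le]; constructor <;> nlinarith
  have b2 : |s * (-x - x^2/2)| ≤ (2*x^3) * (2 * x) := by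
    rw [abs_mul]
    refine mul_le_mul k2 ?_ (abs_nonneg _) (by positivity)
    rw [abs_le]; constructor <;> nlinarith
  have b3 : |r * s| ≤ (2*x^3) * (2*x^3) := by
    rw [abs_mul]
    exact mul_le_mul k1 k2 (abs_nonneg _) (by positivity)
  have x4 := pow_pos h0 4
  rw [abs_le] at b1 b2 b3 ⊢
  constructor <;> nlinarith

lemma aux_sum (x : ℝ) (h0 : 0 < x) (h1 : x ≤ 1/2) :
    |Real.log (1 - x) + Real.log (1 + x) + x^2| ≤ 2 * x^4 := by
  have hx2 : x^2 ≤ 1/4 := by nlinarith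
  have hp : 0 < x^2 := by positivity
  have k1 := Real.abs_log_sub_add_sum_range_le (x := x^2)
    (by rw [abs_of_pos hp]; linarith) 1
  rw [abs_of_pos hp] at k1
  have hb : (x^2)^(1+1) / (1 - x^2) ≤ 2 * x^4 := by
    rw [div_le_iff₀ (by linarith)]
    have h := mul_nonneg (pow_pos h0 4).le (by linarith : 0 ≤ 1 - 2*x^2)
    have e : x^4 * (1 - 2*x^2) = 2 * x^4 * (1 - x^2) - (x^2)^(1+1) := by ring
    rw [e] at h
    exact sub_nonneg.1 h
  have k1 := k1.trans hb
  simp only [Finset.sum_range_succ, Finset.sum_range_zero] at k1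
  norm_num at k1
  rw [← Real.log_mul (by linarith) (by linarith)]
  have : (1 - x) * (1 + x) = 1 - x^2 := by ring
  rw [this, add_comm]
  exact k1

set_option maxHeartbeats 1600000 in
lemma aux_u (n : ℝ) (hn : 3 ≤ n) :
    |(n-1) * Real.log (n-1) * ((n+1) * Real.log (n+1)) / (n * Real.log n)^2
      - (1 + (-1 - 1 / Real.log n - 1 / (Real.log n) ^ 2) / n ^ 2)| ≤ 40 / n^4 := by
  have hn0 : 0 < n := by linarith
  have hL : 1 ≤ Real.log n := by
    rw [Real.le_log_iff_exp_le hn0]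
    linarith [Real.exp_one_lt_d9]
  obtain ⟨x, hx⟩ : ∃ x, x = 1 / n := ⟨_, rfl⟩
  have h0 : 0 < x := by rw [hx]; positivity
  have h1 : x ≤ 1/2 := by rw [hx, div_le_iff₀ hn0]; linarith
  have hnx : n * x = 1 := by rw [hx]; field_simp
  obtain ⟨t, ht⟩ : ∃ t, t = 1 / Real.log n := ⟨_, rfl⟩
  have t0 : 0 < t := by rw [ht]; positivity
  have t1 : t ≤ 1 := by rw [ht, div_le_iff₀ (by linarith)]; linarith
  have l1 : Real.log (n-1) = Real.log n + Real.log (1 - x) := by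
    rw [← Real.log_mul (by linarith) (by linarith)]; congr 1; linarith
  have l2 : Real.log (n+1) = Real.log n + Real.log (1 + x) := by
    rw [← Real.log_mul (by linarith) (by linarith)]; congr 1; linarith
  have k1 := aux_prod x h0 h1
  have k2 := aux_sum x h0 h1
  rw [l1, l2]
  obtain ⟨α, hα⟩ : ∃ α, α = Real.log (1 - x) := ⟨_, rfl⟩
  obtain ⟨β, hβ⟩ : ∃ β, β = Real.log (1 + x) := ⟨_, rfl⟩
  rw [← hα, ← hβ] at k1 k2 ⊢
  have hLn : Real.log n ≠ 0 := by linarith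
  have e : (n-1) * (Real.log n + α) * ((n+1) * (Real.log n + β)) / (n * Real.log n)^2
      - (1 + (-1 - 1 / Real.log n - 1 / (Real.log n) ^ 2) / n ^ 2)
      = (α + β + x^2) * (t - x^2*t) + (α * β + x^2) * (t^2 - x^2*t^2) + x^4 * (t + t^2) := by
    rw [hx, ht]; field_simp; ring
  rw [e]
  have e' : 40 / n^4 = 40 * x^4 := by rw [hx]; field_simp
  rw [e']
  have x4 := pow_pos h0 4
  have x2 : x^2 ≤ 1/4 := by nlinarith
  have tt : t^2 ≤ 1 := by nlinarith
  have tt0 : 0 < t^2 := by positivity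
  have b1 : |(α + β + x^2) * (t - x^2*t)| ≤ (2 * x^4) * 1 := by
    rw [abs_mul]
    refine mul_le_mul k2 ?_ (abs_nonneg _) (by positivity)
    rw [abs_le]; constructor <;> nlinarith
  have b2 : |(α * β + x^2) * (t^2 - x^2*t^2)| ≤ (15 * x^4) * 1 := by
    rw [abs_mul]
    refine mul_le_mul k1 ?_ (abs_nonneg _) (by positivity)
    rw [abs_le]; constructor <;> nlinarith
  have b3 : x^4 * (t + t^2) ≤ x^4 * 2 := by gcongr; linarith
  have b4 : 0 ≤ x^4 * (t + t^2) := by positivity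
  rw [abs_le] at b1 b2 ⊢
  constructor <;> linarith

/-- The final algebraic inequality. -/
lemma aux_alg (t P Q D n : ℝ) (hn : 1 ≤ n) (t0 : 0 < t) (t1 : t ≤ 1/100)
    (hP : 1 + t - t^2 ≤ P) (hQ : 1 + t - t^2 ≤ Q) (hP2 : P ≤ 2) (hQ2 : Q ≤ 2)
    (hD : |D| ≤ 2 + 2*t + 6*t^2) (hnt : 16 / n^2 ≤ t^2) :
    0 < 2 * (P + Q) * (P * Q) - P^2 * Q^2 / n^2 - D^2 := by
  have h1 : 0 < 1 + t - t^2 := by nlinarith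
  have hPQ : (1 + t - t^2) * (1 + t - t^2) ≤ P * Q := mul_le_mul hP hQ h1.le (by linarith)
  have hA : (2 * (2 * (1 + t - t^2))) * ((1 + t - t^2) * (1 + t - t^2))
      ≤ (2 * (P + Q)) * (P * Q) :=
    mul_le_mul (by linarith) hPQ (by positivity) (by linarith)
  have hB : P^2 * Q^2 / n^2 ≤ t^2 := by
    refine le_trans ?_ hnt
    gcongr
    have : P * Q ≤ 2 * 2 := mul_le_mul hP2 hQ2 (by linarith) (by norm_num)
    have h0 : 0 ≤ P * Q := le_trans (by positivity) hPQ
    nlinarith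
  have hC : D^2 ≤ (2 + 2*t + 6*t^2)^2 := by
    rw [← sq_abs]; gcongr
  have : 0 < 4 * (1 + t - t^2)^3 - t^2 - (2 + 2*t + 6*t^2)^2 := by
    have e : 4 * (1 + t - t^2)^3 - t^2 - (2 + 2*t + 6*t^2)^2
      = t * (4 + t * (-29) + t^2 * (-44) + t^3*(-36) + t^4 * 12 - 4 * t^5) := by ring
    rw [e]
    have a2 : t^2 ≤ t := by nlinarith
    have a3 : t^3 ≤ t := by nlinarith [sq_nonneg t]
    have a4 : 0 ≤ t^4 := by positivity
    have a5 : t^5 ≤ t := by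
      have := pow_le_pow_of_le_one t0.le (by linarith) (show 1 ≤ 5 by norm_num)
      simpa using this
    apply mul_pos t0
    nlinarith
  nlinarith

set_option maxHeartbeats 1600000 in
lemma aux_main (n p q : ℝ) (hn : 3 ≤ n) (hL : 100 ≤ Real.log n)
    (hbig : 1000 * (Real.log n)^2 ≤ n)
    (hp : |p - (1 + 1 / Real.log n + 1 / (Real.log n)^2) / n^2| ≤ 40 / n^4)
    (hq : |q - (1 + 1 / Real.log (n+1) + 1 / (Real.log (n+1))^2) / (n+1)^2| ≤ 40 / (n+1)^4) :
    0 < 4 * p * q - (p + q - p * q)^2 := by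
  have hn0 : 0 < n := by linarith
  obtain ⟨t, ht⟩ : ∃ t, t = 1 / Real.log n := ⟨_, rfl⟩
  obtain ⟨s, hs⟩ : ∃ s, s = 1 / Real.log (n+1) := ⟨_, rfl⟩
  have hLL : Real.log n ≤ Real.log (n+1) := Real.log_le_log hn0 (by linarith)
  have hLL2 : Real.log (n+1) - Real.log n ≤ 1 / n := by
    rw [← Real.log_div (by linarith) (by linarith)]
    have := Real.log_le_sub_one_of_pos (show 0 < (n+1)/n by positivity)
    refine this.trans (le_of_eq ?_)
    field_simp; ring
  have t0 : 0 < t := by rw [ht]; positivity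
  have s0 : 0 < s := by rw [hs]; exact one_div_pos.2 (by linarith)
  have t1 : t ≤ 1/100 := by rw [ht]; exact one_div_le_one_div_of_le (by norm_num) hL
  have st : s ≤ t := by
    rw [ht, hs]; exact one_div_le_one_div_of_le (by linarith) hLL
  have hst : n * (t - s) ≤ t * s := by
    have h1 : Real.log n * t = 1 := by rw [ht]; field_simp
    have h2 : Real.log (n+1) * s = 1 := by
      rw [hs]; exact mul_one_div_cancel (by linarith)
    have e : t - s = (t * s) * (Real.log (n+1) - Real.log n) := by
      calc t - s = t * (Real.log (n+1) * s) - s * (Real.log n * t) := by rw [h1, h2]; ring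
        _ = _ := by ring
    rw [e]
    calc n * (t * s * (Real.log (n+1) - Real.log n)) ≤ n * (t * s * (1 / n)) := by gcongr
      _ = t * s := by field_simp
  have hnt : 1000 / n ≤ t^2 := by
    rw [ht, div_le_iff₀ hn0]
    have : (1 / Real.log n)^2 * n ≥ (1 / Real.log n)^2 * (1000 * (Real.log n)^2) := by gcongr
    refine le_trans (le_of_eq ?_) this
    field_simp
  have c1 : (1 + 1 / Real.log n + 1 / (Real.log n)^2) = 1 + t + t^2 := by rw [ht]; ring
  have c2 : (1 + 1 / Real.log (n+1) + 1 / (Real.log (n+1))^2) = 1 + s + s^2 := by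
    rw [hs]; ring
  rw [c1] at hp
  rw [c2] at hq
  obtain ⟨y, hy⟩ : ∃ y, y = 1 / n := ⟨_, rfl⟩
  have y0 : 0 < y := by rw [hy]; positivity
  have hny : n * y = 1 := by rw [hy]; field_simp
  have hyt : 1000 * y ≤ t^2 := by rw [hy]; convert hnt using 1; ring
  have y1 : y ≤ 1/1000 := by nlinarith
  -- scaled quantities
  obtain ⟨e, he⟩ : ∃ e, e = n^2 * p - (1 + t + t^2) := ⟨_, rfl⟩
  obtain ⟨f, hf⟩ : ∃ f, f = n^2 * q - n^2/(n+1)^2 * (1 + s + s^2) := ⟨_, rfl⟩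
  have he' : |e| ≤ 40 * y^2 := by
    have e1 : e = n^2 * (p - (1 + t + t^2) / n^2) := by rw [he]; field_simp
    rw [e1, abs_mul, abs_of_pos (by positivity : 0 < n^2)]
    refine (mul_le_mul_of_nonneg_left hp (by positivity)).trans (le_of_eq ?_)
    rw [hy]; field_simp
  have hf' : |f| ≤ 40 * y^2 := by
    have e1 : f = n^2 * (q - (1 + s + s^2) / (n+1)^2) := by rw [hf]; field_simp
    rw [e1, abs_mul, abs_of_pos (by positivity : 0 < n^2)]
    refine (mul_le_mul_of_nonneg_left hq (by positivity)).trans ?_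
    have : 40 / (n+1)^4 ≤ 40 / n^4 := by gcongr; linarith
    refine (mul_le_mul_of_nonneg_left this (by positivity)).trans (le_of_eq ?_)
    rw [hy]; field_simp
  obtain ⟨g, hg⟩ : ∃ g, g = n * (1 - n^2/(n+1)^2) := ⟨_, rfl⟩
  have g0 : 0 ≤ g := by
    have : g = n * (2*n+1) / (n+1)^2 := by rw [hg]; field_simp; ring
    rw [this]; positivity
  have g2 : g ≤ 2 := by
    have : g = n * (2*n+1) / (n+1)^2 := by rw [hg]; field_simp; ring
    rw [this, div_le_iff₀ (by positivity)]; nlinarith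
  obtain ⟨D, hD⟩ : ∃ D, D = n * (n^2 * p - n^2 * q) := ⟨_, rfl⟩
  have hDe : D = (n * (t - s)) * (1 + (t + s)) + g * (1 + s + s^2) + n * (e - f) := by
    rw [hD, hg, he, hf]; ring
  have hnef : |n * (e - f)| ≤ 80 * y := by
    rw [abs_mul, abs_of_pos hn0]
    have : |e - f| ≤ 80 * y^2 := (abs_sub _ _).trans (by linarith)
    calc n * |e - f| ≤ n * (80 * y^2) := by gcongr
      _ = 80 * y * (n * y) := by ring
      _ = _ := by rw [hny]; ring
  have hts0 : 0 ≤ n * (t - s) := mul_nonneg hn0.le (by linarith)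
  have hts : n * (t - s) ≤ t^2 := by nlinarith
  have ss : s^2 ≤ t^2 := by gcongr
  have hD1 : 0 ≤ (n * (t - s)) * (1 + (t + s)) + g * (1 + s + s^2) := by positivity
  have hD2 : (n * (t - s)) * (1 + (t + s)) + g * (1 + s + s^2)
      ≤ t^2 * 2 + 2 * (1 + t + t^2) := by
    apply add_le_add
    · exact mul_le_mul hts (by linarith) (by positivity) (by positivity)
    · exact mul_le_mul g2 (by linarith) (by positivity) (by positivity)
  have hDabs : |D| ≤ 2 + 2*t + 6*t^2 := by
    rw [hDe]
    rw [abs_le] at hnef ⊢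
    have : 0 ≤ t^2 := by positivity
    constructor <;> linarith
  have tt : t^2 ≤ 1/100 := by nlinarith
  have hy2 : 40 * y^2 ≤ y := by nlinarith
  have hQP : n^2 * q = n^2 * p - y * D := by
    rw [hD]; linear_combination (-(n^2*q) + n^2 * p) * hny
  have hyD : |y * D| ≤ 5 * y := by
    rw [abs_mul, abs_of_pos y0, mul_comm]
    exact mul_le_mul_of_nonneg_right (by linarith) y0.le
  rw [abs_le] at he' hyD
  have hyy : 0 ≤ y^2 := by positivity
  have key := aux_alg t (n^2*p) (n^2*q) D n (by linarith) t0 t1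
    (by linarith) (by linarith) (by linarith) (by linarith) hDabs
    (by
      have : 16 / n^2 = 16 * y^2 := by rw [hy]; field_simp
      rw [this]; linarith)
  have efin : 2 * (n^2*p + n^2*q) * ((n^2*p) * (n^2*q)) - (n^2*p)^2 * (n^2*q)^2 / n^2 - D^2
      = n^6 * (4 * p * q - (p + q - p * q)^2) := by
    rw [hD]; field_simp; ring
  rw [efin] at key
  exact (mul_pos_iff_of_pos_left (by positivity)).1 key

theorem stmt15 (a u : ℕ → ℝ)
    (ha : ∀ n : ℕ, 2 ≤ n → a n = (n : ℝ) * Real.log n)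
    (hu : ∀ n : ℕ, 3 ≤ n → u n = a (n - 1) * a (n + 1) / (a n) ^ 2) :
    ((fun n : ℕ => u n - (1 + (-1 - 1 / Real.log n - 1 / (Real.log n) ^ 2) / (n : ℝ) ^ 2))
        =o[atTop] fun n : ℕ => 1 / (n : ℝ) ^ 3) ∧
    ∀ᶠ n : ℕ in atTop,
      0 < 4 * ((a n) ^ 2 - a (n - 1) * a (n + 1)) * ((a (n + 1)) ^ 2 - a n * a (n + 2))
          - (a n * a (n + 1) - a (n - 1) * a (n + 2)) ^ 2 := by
  have hbound : ∀ n : ℕ, 3 ≤ n →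
      |u n - (1 + (-1 - 1 / Real.log n - 1 / (Real.log n) ^ 2) / (n : ℝ) ^ 2)|
        ≤ 40 / (n : ℝ)^4 := by
    intro n hn
    have h3 : (3 : ℝ) ≤ n := by exact_mod_cast hn
    rw [hu n hn, ha n (by omega), ha (n-1) (by omega), ha (n+1) (by omega),
      Nat.cast_sub (by omega : 1 ≤ n)]
    push_cast
    exact aux_u n h3
  constructor
  · have hO : (fun n : ℕ => u n - (1 + (-1 - 1 / Real.log n - 1 / (Real.log n) ^ 2)
        / (n : ℝ) ^ 2)) =O[atTop] fun n : ℕ => 1 / (n : ℝ) ^ 4 := by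
      refine IsBigO.of_bound 40 ?_
      filter_upwards [eventually_ge_atTop 3] with n hn
      have := hbound n hn
      rw [Real.norm_eq_abs, Real.norm_eq_abs, abs_of_nonneg (by positivity : 0 ≤ 1 / (n:ℝ)^4)]
      refine this.trans (le_of_eq ?_)
      ring
    refine hO.trans_isLittleO ?_
    rw [isLittleO_iff_tendsto']
    · have := tendsto_one_div_atTop_nhds_zero_nat (𝕜 := ℝ)
      refine this.congr' ?_
      filter_upwards [eventually_ge_atTop 1] with n hn
      have : (n : ℝ) ≠ 0 := by positivity
      field_simp
    · filter_upwards [eventually_ge_atTop 1] with n hn h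
      have : (n : ℝ) ≠ 0 := by positivity
      exfalso
      have : 1 / (n : ℝ)^3 ≠ 0 := by positivity
      exact this h
  · have hlog : Tendsto (fun n : ℕ => Real.log (n : ℝ)) atTop atTop :=
      Real.tendsto_log_atTop.comp tendsto_natCast_atTop_atTop
    have hlit : (fun x : ℝ => Real.log x ^ 2) =o[atTop] (fun x : ℝ => x) :=
      Real.isLittleO_pow_log_id_atTop
    have hbig : ∀ᶠ n : ℕ in atTop, 1000 * (Real.log (n:ℝ))^2 ≤ n := by
      have h1 := hlit.bound (show (0:ℝ) < 1/1000 by norm_num)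
      have h2 := tendsto_natCast_atTop_atTop (R := ℝ) |>.eventually h1
      filter_upwards [h2] with n hn
      rw [Real.norm_eq_abs, Real.norm_eq_abs, abs_of_nonneg (by positivity),
        abs_of_nonneg (by positivity)] at hn
      linarith
    filter_upwards [hbig, hlog.eventually_ge_atTop 100, eventually_ge_atTop 3] with n h1 h2 hn
    have h3 : (3 : ℝ) ≤ n := by exact_mod_cast hn
    have b1 := hbound n hn
    have b2 := hbound (n+1) (by omega)
    push_cast at b2
    have key := aux_main n (1 - u n) (1 - u (n+1)) h3 h2 h1
      (by
        rw [abs_sub_comm] at b1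
        refine le_trans (le_of_eq ?_) b1
        congr 1; ring)
      (by
        rw [abs_sub_comm] at b2
        refine le_trans (le_of_eq ?_) b2
        congr 1; ring)
    have p1 : 0 < a n := by
      rw [ha n (by omega)]; exact mul_pos (by linarith) (by linarith)
    have p2 : 0 < a (n+1) := by
      rw [ha (n+1) (by omega)]
      refine mul_pos (by positivity) (Real.log_pos ?_)
      push_cast; linarith
    have u1 := hu n hn
    have u2 := hu (n+1) (by omega)
    rw [show n + 1 - 1 = n by omega, show n + 1 + 1 = n + 2 by omega] at u2
    rw [u1, u2] at key
    have hpos : 0 < (a n)^2 * (a (n+1))^2 := by positivity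
    have := mul_pos hpos key
    refine lt_of_lt_of_eq this ?_
    field_simp
    ring
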